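/- (Lemma 5) Let N ≥ 2, let Δ_N be a classical state space with N pure states δ_1, …, δ_N (an (N−1)-simplex: the convex hull of N affinely independent points whose affine hull avoids 0), and let Ω_app be a state space with fixed states ξ_1, …, ξ_N ∈ Ω_app. Suppose that for every family τ_1, …, τ_N of N pairwise distinct channels on Δ_N there exists a channel Θ on Δ_N ⊗_min Ω_app such that ξ_n implements τ_n through Θ for every n. Then ξ_1, …, ξ_N are perfectly distinguishable: there exists an observable {A_k}_{k=1}^N on Ω_app with A_k(ξ_n) = δ_{kn}. -/

import Mathlib

open scoped BigOperators

/-- A state space: a compact convex subset `Ω` of a finite-dimensional real vector space `V`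
which spans `V` and whose affine hull does not contain the origin. -/
def IsStateSpace {V : Type*} [NormedAddCommGroup V] [NormedSpace ℝ V] (Ω : Set V) : Prop :=
  IsCompact Ω ∧ Convex ℝ Ω ∧ Submodule.span ℝ Ω = ⊤ ∧ (0 : V) ∉ (affineSpan ℝ Ω : Set V)

/-- An effect on `Ω`: a linear functional taking values in `[0,1]` on `Ω`. -/
def IsEffect {V : Type*} [AddCommGroup V] [Module ℝ V] (Ω : Set V) (e : V →ₗ[ℝ] ℝ) : Prop :=
  ∀ ω ∈ Ω, e ω ∈ Set.Icc (0 : ℝ) 1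

/-- The unit effect on `Ω`: the linear functional equal to `1` on `Ω`. -/
def IsUnitEffect {V : Type*} [AddCommGroup V] [Module ℝ V] (Ω : Set V)
    (u : V →ₗ[ℝ] ℝ) : Prop :=
  ∀ ω ∈ Ω, u ω = 1

/-- An observable on `Ω`: a finite family of effects summing to the unit effect. -/
def IsObservable {V : Type*} [AddCommGroup V] [Module ℝ V] (Ω : Set V) {X : Type*} [Fintype X]
    (e : X → (V →ₗ[ℝ] ℝ)) : Prop :=
  (∀ x, IsEffect Ω (e x)) ∧ ∀ ω ∈ Ω, ∑ x, e x ω = 1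

/-- The fidelity of two states `ω, σ ∈ Ω`: the infimum over all observables `{e_x}` on `Ω`
of `∑ x, √(e_x ω) · √(e_x σ)`. -/
noncomputable def fidelity {V : Type*} [AddCommGroup V] [Module ℝ V] (Ω : Set V)
    (ω σ : V) : ℝ :=
  sInf { r | ∃ (nn : ℕ) (e : Fin nn → (V →ₗ[ℝ] ℝ)), IsObservable Ω e ∧
    r = ∑ x, Real.sqrt (e x ω) * Real.sqrt (e x σ) }

/-- The tensor product of two states, realized in the function space indexed by the
product of the index sets. -/
def tmul {ι₁ ι₂ : Type} (ω : ι₁ → ℝ) (σ : ι₂ → ℝ) : ι₁ × ι₂ → ℝ :=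
  fun p => ω p.1 * σ p.2

/-- Auxiliary: partial application of a functional on the second factor. -/
def curryMap {ι₁ ι₂ : Type} (f : (ι₂ → ℝ) →ₗ[ℝ] ℝ) : (ι₁ × ι₂ → ℝ) →ₗ[ℝ] (ι₁ → ℝ) where
  toFun μ := fun i => f (fun j => μ (i, j))
  map_add' μ ν := by funext i; exact f.map_add _ _
  map_smul' c μ := by funext i; exact f.map_smul c _

/-- The tensor product `e ⊗ f` of two effects, as a linear functional on the
composite space; it satisfies `(e ⊗ f)(ω ⊗ σ) = e ω · f σ`. -/
def etmul {ι₁ ι₂ : Type} (e : (ι₁ → ℝ) →ₗ[ℝ] ℝ) (f : (ι₂ → ℝ) →ₗ[ℝ] ℝ) :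
    (ι₁ × ι₂ → ℝ) →ₗ[ℝ] ℝ :=
  e.comp (curryMap f)

/-- The linear map `β ⊗ id` on the composite space. -/
def lTensorId {ι₁ ι₂ : Type} (β : (ι₁ → ℝ) →ₗ[ℝ] (ι₁ → ℝ)) :
    (ι₁ × ι₂ → ℝ) →ₗ[ℝ] (ι₁ × ι₂ → ℝ) where
  toFun μ := fun p => β (fun i => μ (i, p.2)) p.1
  map_add' μ ν := by funext p; exact congrFun (β.map_add _ _) p.1
  map_smul' c μ := by funext p; exact congrFun (β.map_smul c _) p.1

/-- The minimal tensor product of two state spaces: the convex hull of product states. -/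
def minTensor {ι₁ ι₂ : Type} (Ω₁ : Set (ι₁ → ℝ)) (Ω₂ : Set (ι₂ → ℝ)) :
    Set (ι₁ × ι₂ → ℝ) :=
  convexHull ℝ {μ | ∃ ω ∈ Ω₁, ∃ σ ∈ Ω₂, μ = tmul ω σ}

/-- The maximal tensor product of two state spaces: all `μ` normalized by the unit effects
and giving nonnegative probabilities on all product effects. -/
def maxTensor {ι₁ ι₂ : Type} (Ω₁ : Set (ι₁ → ℝ)) (Ω₂ : Set (ι₂ → ℝ)) :
    Set (ι₁ × ι₂ → ℝ) :=
  {μ | (∀ u₁ u₂, IsUnitEffect Ω₁ u₁ → IsUnitEffect Ω₂ u₂ → etmul u₁ u₂ μ = 1) ∧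
    ∀ e f, IsEffect Ω₁ e → IsEffect Ω₂ f → 0 ≤ etmul e f μ}

/-- A composite state space of `Ω₁` and `Ω₂`: a compact convex set between the minimal
and the maximal tensor products. -/
def IsComposite {ι₁ ι₂ : Type} [Fintype ι₁] [Fintype ι₂] (Ω₁ : Set (ι₁ → ℝ))
    (Ω₂ : Set (ι₂ → ℝ)) (Ωtot : Set (ι₁ × ι₂ → ℝ)) : Prop :=
  IsCompact Ωtot ∧ Convex ℝ Ωtot ∧ minTensor Ω₁ Ω₂ ⊆ Ωtot ∧ Ωtot ⊆ maxTensor Ω₁ Ω₂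

/-- A program `ξ ∈ Ω_app` implements the dynamics `α` on `Ω_sys` through the dynamics `Λ`
on the composite: `(e ⊗ u_app)(Λ(ω ⊗ ξ)) = e(α ω)` for all states `ω` and effects `e`. -/
def Implements {ι₁ ι₂ : Type} (Ωsys : Set (ι₁ → ℝ)) (Ωapp : Set (ι₂ → ℝ))
    (Λ : (ι₁ × ι₂ → ℝ) →ₗ[ℝ] (ι₁ × ι₂ → ℝ)) (ξ : ι₂ → ℝ)
    (α : (ι₁ → ℝ) →ₗ[ℝ] (ι₁ → ℝ)) : Prop :=
  ∀ ω ∈ Ωsys, ∀ e : (ι₁ → ℝ) →ₗ[ℝ] ℝ, IsEffect Ωsys e →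
    ∀ u₂ : (ι₂ → ℝ) →ₗ[ℝ] ℝ, IsUnitEffect Ωapp u₂ →
      etmul e u₂ (Λ (tmul ω ξ)) = e (α ω)

theorem IsStateSpace.exists_isUnitEffect {V : Type*} [NormedAddCommGroup V] [NormedSpace ℝ V]
    {Ω : Set V} (h : IsStateSpace Ω) : ∃ u : V →ₗ[ℝ] ℝ, IsUnitEffect Ω u := by
  obtain ⟨-, -, -, h0⟩ := h
  rcases Ω.eq_empty_or_nonempty with rfl | ⟨x, hx⟩
  · exact ⟨0, fun ω hω => hω.elim⟩
  have hx' : x ∈ affineSpan ℝ Ω := subset_affineSpan ℝ Ω hx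
  have hxd : x ∉ (affineSpan ℝ Ω).direction := fun hd => by
    have := AffineSubspace.vadd_mem_of_mem_direction (neg_mem hd) hx'
    exact h0 (by simpa using this)
  obtain ⟨f, hfx, hf⟩ := Submodule.exists_le_ker_of_notMem hxd
  refine ⟨(f x)⁻¹ • f, fun ω hω => ?_⟩
  have hker : f (ω - x) = 0 :=
    hf (AffineSubspace.vsub_mem_direction (subset_affineSpan ℝ Ω hω) hx')
  rw [map_sub, sub_eq_zero] at hker
  simp [hker, hfx]

theorem AffineIndependent.linearIndependent_of_map_eq_one {V ι : Type*} [AddCommGroup V]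
    [Module ℝ V] [Fintype ι] {δ : ι → V} (hδ : AffineIndependent ℝ δ) (u : V →ₗ[ℝ] ℝ)
    (hu : ∀ i, u (δ i) = 1) : LinearIndependent ℝ δ := by
  rw [Fintype.linearIndependent_iff]
  intro g hg i
  have hsum : ∑ i, g i = 0 := by simpa [hu] using congrArg u hg
  exact affineIndependent_iff.1 hδ Finset.univ g hsum hg i (Finset.mem_univ i)

theorem etmul_tmul {ι₁ ι₂ : Type} (e : (ι₁ → ℝ) →ₗ[ℝ] ℝ) (f : (ι₂ → ℝ) →ₗ[ℝ] ℝ)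
    (ω : ι₁ → ℝ) (σ : ι₂ → ℝ) : etmul e f (tmul ω σ) = e ω * f σ := by
  have h : curryMap f (tmul ω σ) = f σ • ω := by
    funext i
    exact (f.map_smul (ω i) σ).trans (mul_comm _ _)
  simp [etmul, h, mul_comm]

/-- Tensoring with a fixed state on the left, as a linear map. -/
def tmulLeft {ι₁ ι₂ : Type} (ω : ι₁ → ℝ) : (ι₂ → ℝ) →ₗ[ℝ] (ι₁ × ι₂ → ℝ) where
  toFun σ := tmul ω σ
  map_add' σ τ := by funext p; simp [tmul, mul_add]
  map_smul' c σ := by funext p; simp [tmul, mul_left_comm]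

theorem IsEffect.etmul_isUnitEffect {ι₁ ι₂ : Type} {Ω₁ : Set (ι₁ → ℝ)} {Ω₂ : Set (ι₂ → ℝ)}
    {e : (ι₁ → ℝ) →ₗ[ℝ] ℝ} {u : (ι₂ → ℝ) →ₗ[ℝ] ℝ} (he : IsEffect Ω₁ e)
    (hu : IsUnitEffect Ω₂ u) : IsEffect (minTensor Ω₁ Ω₂) (etmul e u) := by
  refine convexHull_min (t := etmul e u ⁻¹' Set.Icc 0 1) ?_
    ((convex_Icc 0 1).linear_preimage (etmul e u))
  rintro _ ⟨ω, hω, σ, hσ, rfl⟩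
  simpa [etmul_tmul, hu σ hσ] using he ω hω

theorem IsObservable.etmul_isUnitEffect {ι₁ ι₂ X : Type} [Fintype X] {Ω₁ : Set (ι₁ → ℝ)}
    {Ω₂ : Set (ι₂ → ℝ)} {e : X → (ι₁ → ℝ) →ₗ[ℝ] ℝ} {u : (ι₂ → ℝ) →ₗ[ℝ] ℝ}
    (he : IsObservable Ω₁ e) (hu : IsUnitEffect Ω₂ u) :
    IsObservable (minTensor Ω₁ Ω₂) fun x => etmul (e x) u := by
  refine ⟨fun x => (he.1 x).etmul_isUnitEffect hu, ?_⟩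
  have hmin := convexHull_min (s := {μ | ∃ ω ∈ Ω₁, ∃ σ ∈ Ω₂, μ = tmul ω σ}) ?_
    ((convex_singleton (1 : ℝ)).linear_preimage (∑ x, etmul (e x) u))
  · intro μ hμ
    simpa using hmin hμ
  · rintro _ ⟨ω, hω, σ, hσ, rfl⟩
    simpa [etmul_tmul, hu σ hσ] using he.2 ω hω

theorem Module.Basis.isObservable_coord {V ι : Type*} [AddCommGroup V] [Module ℝ V] [Fintype ι]
    (b : Module.Basis ι ℝ V) : IsObservable (convexHull ℝ (Set.range b)) b.coord := by
  classical
  constructor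
  · intro k
    refine convexHull_min (t := b.coord k ⁻¹' Set.Icc 0 1) ?_
      ((convex_Icc 0 1).linear_preimage (b.coord k))
    rintro _ ⟨n, rfl⟩
    by_cases h : n = k <;> simp [h]
  · have hmin := convexHull_min (s := Set.range b) ?_
      ((convex_singleton (1 : ℝ)).linear_preimage (∑ k, b.coord k))
    · intro ω hω
      simpa using hmin hω
    · rintro _ ⟨n, rfl⟩
      simp [Finsupp.single_apply]

/-- Lemma 5: if fixed apparatus states `ξ₁, …, ξ_N` can program every family of `N`
pairwise distinct channels on a classical system with `N` pure states (through some
channel on the minimal tensor product), then the states `ξ₁, …, ξ_N` are perfectly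
distinguishable. -/
theorem channel_programming_implies_distinguishable {ι₁ ι₂ : Type} [Fintype ι₁] [Fintype ι₂]
    (N : ℕ) (hN : 2 ≤ N)
    (δ : Fin N → (ι₁ → ℝ)) (hδ : AffineIndependent ℝ δ)
    (Ωsys : Set (ι₁ → ℝ)) (hΩsys : Ωsys = convexHull ℝ (Set.range δ))
    (hsys : IsStateSpace Ωsys)
    (Ωapp : Set (ι₂ → ℝ)) (happ : IsStateSpace Ωapp)
    (ξ : Fin N → (ι₂ → ℝ)) (hξ : ∀ n, ξ n ∈ Ωapp)
    (hprog : ∀ τ : Fin N → ((ι₁ → ℝ) →ₗ[ℝ] (ι₁ → ℝ)),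
      (∀ n, Set.MapsTo (τ n) Ωsys Ωsys) →
      (∀ i j : Fin N, i ≠ j → ∃ ω ∈ Ωsys, τ i ω ≠ τ j ω) →
      ∃ Θ : (ι₁ × ι₂ → ℝ) →ₗ[ℝ] (ι₁ × ι₂ → ℝ),
        Set.MapsTo Θ (minTensor Ωsys Ωapp) (minTensor Ωsys Ωapp) ∧
        ∀ n, Implements Ωsys Ωapp Θ (ξ n) (τ n)) :
    ∃ A : Fin N → ((ι₂ → ℝ) →ₗ[ℝ] ℝ), IsObservable Ωapp A ∧
      ∀ k n : Fin N, A k (ξ n) = if k = n then 1 else 0 := by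
  obtain ⟨u₁, hu₁⟩ := hsys.exists_isUnitEffect
  obtain ⟨u₂, hu₂⟩ := happ.exists_isUnitEffect
  have hmem : ∀ n, δ n ∈ Ωsys := fun n => hΩsys ▸ subset_convexHull ℝ _ ⟨n, rfl⟩
  have hli : LinearIndependent ℝ δ :=
    hδ.linearIndependent_of_map_eq_one u₁ fun n => hu₁ _ (hmem n)
  have hspan : ⊤ ≤ Submodule.span ℝ (Set.range δ) := by
    rw [← hsys.2.2.1, Submodule.span_le, hΩsys]
    exact convexHull_min Submodule.subset_span (Submodule.convex _)
  let b := Module.Basis.mk hli hspan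
  have hb : ∀ n, b n = δ n := fun n => Module.Basis.mk_apply hli hspan n
  have hobs : IsObservable Ωsys b.coord := by
    rw [hΩsys, ← funext hb]
    exact b.isObservable_coord
  let z : Fin N := ⟨0, by omega⟩
  have happly : ∀ n, ∀ ω ∈ Ωsys, u₁.smulRight (δ n) ω = δ n := fun n ω hω => by
    simp [hu₁ ω hω]
  obtain ⟨Θ, hΘ, himp⟩ := hprog (fun n => u₁.smulRight (δ n))
    (fun n ω hω => (happly n ω hω).symm ▸ hmem n)
    (fun i j hij => ⟨δ z, hmem z, by
      rw [happly i _ (hmem z), happly j _ (hmem z)]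
      exact hli.injective.ne hij⟩)
  have hmaps : ∀ σ ∈ Ωapp, Θ (tmul (δ z) σ) ∈ minTensor Ωsys Ωapp := fun σ hσ =>
    hΘ (subset_convexHull ℝ _ ⟨_, hmem z, σ, hσ, rfl⟩)
  have hobs' := hobs.etmul_isUnitEffect hu₂
  refine ⟨fun k => etmul (b.coord k) u₂ ∘ₗ Θ ∘ₗ tmulLeft (δ z),
    ⟨fun k σ hσ => hobs'.1 k _ (hmaps σ hσ), fun σ hσ => hobs'.2 _ (hmaps σ hσ)⟩,
    fun k n => ?_⟩
  refine (himp n _ (hmem z) _ (hobs.1 k) u₂ hu₂).trans ?_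
  rw [happly n _ (hmem z), ← hb n]
  simp [Finsupp.single_apply, eq_comm]
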